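/- Let Φ(ρ) = ∑_i K_i ρ K_i† be a quantum channel on ℂ^a given by Kraus operators with ∑_i K_i† K_i = I, let |G⟩ be a unit vector in ℂ^a ⊗ ℂ^b with reduced density matrix γ = Tr_B(|G⟩⟨G|) on ℂ^a, and set ζ = (Φ ⊗ I)(|G⟩⟨G|) = ∑_i (K_i ⊗ I)|G⟩⟨G|(K_i ⊗ I)†. Then S(γ) − S(Φ(γ)) ≤ S(ζ). (Any quantum map that locally decreases entropy by ΔS must globally increase entropy by at least ΔS.) -/

import Mathlib

open scoped Matrix Kronecker BigOperators Classical ComplexOrder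

/-- A density matrix: positive semidefinite with unit trace. -/
noncomputable def IsDensity {n : Type*} [Fintype n] (ρ : Matrix n n ℂ) : Prop :=
  ρ.PosSemidef ∧ ρ.trace = 1

/-- A unitary matrix. -/
noncomputable def IsUnitary {n : Type*} [Fintype n] [DecidableEq n] (U : Matrix n n ℂ) : Prop :=
  U * Uᴴ = 1 ∧ Uᴴ * U = 1

/-- Partial trace over the first tensor factor. -/
noncomputable def trFst {α β : Type*} [Fintype α] (M : Matrix (α × β) (α × β) ℂ) : Matrix β β ℂ :=
  Matrix.of fun k l => ∑ i, M (i, k) (i, l)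

/-- Partial trace over the second tensor factor. -/
noncomputable def trSnd {α β : Type*} [Fintype β] (M : Matrix (α × β) (α × β) ℂ) : Matrix α α ℂ :=
  Matrix.of fun i j => ∑ k, M (i, k) (j, k)

/-- Partial trace over the third factor of a tripartite system. -/
noncomputable def trThird {α β γ : Type*} [Fintype γ] (M : Matrix (α × β × γ) (α × β × γ) ℂ) :
    Matrix (α × β) (α × β) ℂ :=
  Matrix.of fun p q => ∑ k, M (p.1, p.2, k) (q.1, q.2, k)

/-- von Neumann entropy (base-2), with the convention `0 log 0 = 0`. -/
noncomputable def vnEntropy {n : Type*} [Fintype n] [DecidableEq n] (ρ : Matrix n n ℂ) : ℝ :=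
  if h : ρ.IsHermitian then -∑ i, h.eigenvalues i * Real.logb 2 (h.eigenvalues i) else 0

/-- Largest eigenvalue of a (Hermitian) matrix. -/
noncomputable def maxEig {n : Type*} [Fintype n] [DecidableEq n] (ρ : Matrix n n ℂ) : ℝ :=
  if h : ρ.IsHermitian then ⨆ i, h.eigenvalues i else 0

/-- Min-entropy of a density matrix. -/
noncomputable def minEntropy {n : Type*} [Fintype n] [DecidableEq n] (ρ : Matrix n n ℂ) : ℝ :=
  -Real.logb 2 (maxEig ρ)

/-- Rényi entropy of order `α` (base 2). -/
noncomputable def renyiEntropy {n : Type*} [Fintype n] [DecidableEq n] (α : ℝ)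
    (ρ : Matrix n n ℂ) : ℝ :=
  if h : ρ.IsHermitian then (1 - α)⁻¹ * Real.logb 2 (∑ i, h.eigenvalues i ^ α) else 0

/-- Partial transpose over the first tensor factor. -/
noncomputable def ptFst {α β : Type*} (U : Matrix (α × β) (α × β) ℂ) : Matrix (α × β) (α × β) ℂ :=
  Matrix.of fun p q => U (q.1, p.2) (p.1, q.2)

/-- Swap the two parties of a bipartite matrix. -/
noncomputable def swapParties {α β : Type*} (U : Matrix (α × β) (α × β) ℂ) : Matrix (β × α) (β × α) ℂ :=
  Matrix.of fun p q => U (p.2, p.1) (q.2, q.1)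

/-- `U` is compatible with the catalyst `σ`: there is a unitary `V` on `B` such that
`Tr_A (U (ρ ⊗ σ) U†) = V σ V†` for every density matrix `ρ` on `A`. -/
noncomputable def Compatible {dA dB : ℕ} (U : Matrix (Fin dA × Fin dB) (Fin dA × Fin dB) ℂ)
    (σ : Matrix (Fin dB) (Fin dB) ℂ) : Prop :=
  ∃ V : Matrix (Fin dB) (Fin dB) ℂ, IsUnitary V ∧
    ∀ ρ : Matrix (Fin dA) (Fin dA) ℂ, IsDensity ρ →
      trFst (U * (ρ ⊗ₖ σ) * Uᴴ) = V * σ * Vᴴ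

/-- The unitary `1_m ⊗ U` on `ℂ^m ⊗ ℂ^{dA} ⊗ ℂ^{dB}`, indexed as `(Fin m × Fin dA) × Fin dB`. -/
noncomputable def extUnitary {m dA dB : ℕ} (U : Matrix (Fin dA × Fin dB) (Fin dA × Fin dB) ℂ) :
    Matrix ((Fin m × Fin dA) × Fin dB) ((Fin m × Fin dA) × Fin dB) ℂ :=
  Matrix.of fun p q => if p.1.1 = q.1.1 then U (p.1.2, p.2) (q.1.2, q.2) else 0

lemma ent_classical {κ ι τ : Type*} [Fintype κ] [Fintype ι] [Fintype τ]
    (p : κ → ℝ) (α : ι → ℝ) (β : τ → ℝ) (D : ι → τ → κ → ℝ)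
    (hp : ∀ k, 0 ≤ p k) (hD : ∀ i j k, 0 ≤ D i j k)
    (hs : ∑ k, p k = 1)
    (h1 : ∀ k, ∑ i, ∑ j, D i j k = 1) (h2 : ∀ i j, ∑ k, D i j k = 1)
    (hα : ∀ i, ∑ j, ∑ k, D i j k * p k = α i)
    (hβ : ∀ j, ∑ i, ∑ k, D i j k * p k = β j) :
    ∑ i, α i * Real.logb 2 (α i) + ∑ j, β j * Real.logb 2 (β j)
      ≤ ∑ k, p k * Real.logb 2 (p k) := by
  have hDp : ∀ i j k, 0 ≤ D i j k * p k := fun i j k => mul_nonneg (hD i j k) (hp k)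
  have hα0 : ∀ i, 0 ≤ α i := fun i => by
    rw [← hα]; exact Finset.sum_nonneg fun j _ => Finset.sum_nonneg fun k _ => hDp i j k
  have hβ0 : ∀ i, 0 ≤ β i := fun i => by
    rw [← hβ]; exact Finset.sum_nonneg fun j _ => Finset.sum_nonneg fun k _ => hDp j i k
  have leα : ∀ i j k, D i j k * p k ≤ α i := fun i j k => by
    rw [← hα]
    refine le_trans ?_ (Finset.single_le_sum (f := fun j => ∑ k, D i j k * p k)
      (fun j _ => Finset.sum_nonneg fun k _ => hDp i j k) (Finset.mem_univ j))
    exact Finset.single_le_sum (f := fun k => D i j k * p k) (fun k _ => hDp i j k)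
      (Finset.mem_univ k)
  have leβ : ∀ i j k, D i j k * p k ≤ β j := fun i j k => by
    rw [← hβ]
    refine le_trans ?_ (Finset.single_le_sum (f := fun i => ∑ k, D i j k * p k)
      (fun i _ => Finset.sum_nonneg fun k _ => hDp i j k) (Finset.mem_univ i))
    exact Finset.single_le_sum (f := fun k => D i j k * p k) (fun k _ => hDp i j k)
      (Finset.mem_univ k)
  have swap3 : ∀ f : ι → τ → κ → ℝ, ∑ i, ∑ j, ∑ k, f i j k = ∑ k, ∑ i, ∑ j, f i j k := by
    intro f
    rw [Finset.sum_comm]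
    have : ∀ y, ∑ x, ∑ k, f x y k = ∑ k, ∑ x, f x y k := fun y => Finset.sum_comm
    simp_rw [this]
    rw [Finset.sum_comm]
    exact Finset.sum_congr rfl fun k _ => Finset.sum_comm
  have sDp : ∑ i, ∑ j, ∑ k, D i j k * p k = 1 := by
    rw [swap3, ← hs]
    refine Finset.sum_congr rfl fun k _ => ?_
    simp_rw [← Finset.sum_mul]
    rw [h1, one_mul]
  have sα : ∑ i, α i = 1 := by rw [← sDp]; exact Finset.sum_congr rfl fun i _ => (hα i).symm
  have sβ : ∑ i, β i = 1 := by
    rw [← sDp, Finset.sum_comm]; exact Finset.sum_congr rfl fun i _ => (hβ i).symm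
  -- pointwise inequality
  have key : ∀ i j k, D i j k * p k - D i j k * (α i * β j) ≤
      D i j k * p k * Real.log (p k) - D i j k * p k * Real.log (α i)
        - D i j k * p k * Real.log (β j) := by
    intro i j k
    rcases eq_or_lt_of_le (hDp i j k) with h | h
    · rw [← h]
      have := mul_nonneg (hD i j k) (mul_nonneg (hα0 i) (hβ0 j))
      simp only [zero_mul]; linarith
    · have ha : 0 < α i := lt_of_lt_of_le h (leα i j k)
      have hb : 0 < β j := lt_of_lt_of_le h (leβ i j k)
      have hpk : 0 < p k := by
        rcases eq_or_lt_of_le (hp k) with h' | h'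
        · rw [← h'] at h; simp at h
        · exact h'
      have := Real.log_le_sub_one_of_pos (div_pos (mul_pos ha hb) hpk)
      rw [Real.log_div (mul_pos ha hb).ne' hpk.ne', Real.log_mul ha.ne' hb.ne'] at this
      have h3 := mul_le_mul_of_nonneg_left this h.le
      have h4 : D i j k * p k * (α i * β j / p k - 1) = D i j k * (α i * β j) - D i j k * p k := by
        field_simp
      rw [h4] at h3
      linarith
  have tot := Finset.sum_le_sum fun i (_ : i ∈ Finset.univ) =>
    Finset.sum_le_sum fun j (_ : j ∈ Finset.univ) =>
      Finset.sum_le_sum fun k (_ : k ∈ Finset.univ) => key i j k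
  simp only [Finset.sum_sub_distrib] at tot
  have e1 : ∑ i, ∑ j, ∑ k, D i j k * (α i * β j) = 1 := by
    simp_rw [← Finset.sum_mul, h2, one_mul, ← Finset.mul_sum, sβ, mul_one, sα]
  have e2 : ∑ i, ∑ j, ∑ k, D i j k * p k * Real.log (p k) = ∑ k, p k * Real.log (p k) := by
    rw [swap3]
    refine Finset.sum_congr rfl fun k _ => ?_
    simp_rw [← Finset.sum_mul]
    rw [h1, one_mul]
  have e3 : ∑ i, ∑ j, ∑ k, D i j k * p k * Real.log (α i) = ∑ k, α k * Real.log (α k) := by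
    refine Finset.sum_congr rfl fun k _ => ?_
    simp_rw [← Finset.sum_mul]
    rw [hα]
  have e4 : ∑ i, ∑ j, ∑ k, D i j k * p k * Real.log (β j) = ∑ k, β k * Real.log (β k) := by
    rw [Finset.sum_comm]
    refine Finset.sum_congr rfl fun k _ => ?_
    simp_rw [← Finset.sum_mul]
    rw [hβ]
  rw [sDp, e1, e2, e3, e4] at tot
  simp only [Real.logb, mul_div_assoc', ← Finset.sum_div]
  rw [← add_div]
  exact div_le_div_of_nonneg_right (by linarith) (Real.log_nonneg (by norm_num))

lemma ent_eq_roots {n : Type*} [Fintype n] [DecidableEq n] {ρ : Matrix n n ℂ}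
    (h : ρ.IsHermitian) :
    vnEntropy ρ = -(ρ.charpoly.roots.map fun z : ℂ => z.re * Real.logb 2 z.re).sum := by
  rw [vnEntropy, dif_pos h, h.roots_charpoly_eq_eigenvalues]
  simp [Multiset.map_map, Function.comp_def]

lemma ent_mul_comm {m n : Type*} [Fintype m] [DecidableEq m] [Fintype n] [DecidableEq n]
    (M : Matrix m n ℂ) : vnEntropy (M * Mᴴ) = vnEntropy (Mᴴ * M) := by
  rw [ent_eq_roots (Matrix.isHermitian_mul_conjTranspose_self M),
    ent_eq_roots (Matrix.isHermitian_conjTranspose_mul_self M)]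
  have h := congrArg Polynomial.roots (Matrix.charpoly_mul_comm' M Mᴴ)
  rw [Polynomial.roots_mul, Polynomial.roots_mul] at h
  · have h' := congrArg (fun s : Multiset ℂ =>
      (s.map fun z : ℂ => z.re * Real.logb 2 z.re).sum) h
    simpa [Multiset.map_nsmul, Multiset.sum_nsmul] using h'
  · exact mul_ne_zero (pow_ne_zero _ Polynomial.X_ne_zero) (Matrix.charpoly_monic _).ne_zero
  · exact mul_ne_zero (pow_ne_zero _ Polynomial.X_ne_zero) (Matrix.charpoly_monic _).ne_zero

lemma ent_transpose {n : Type*} [Fintype n] [DecidableEq n] {ρ : Matrix n n ℂ}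
    (h : ρ.IsHermitian) : vnEntropy ρᵀ = vnEntropy ρ := by
  rw [ent_eq_roots h, ent_eq_roots h.transpose, Matrix.charpoly_transpose]

lemma trSnd_conj {α β : Type*} [Fintype α] [DecidableEq α] [Fintype β] [DecidableEq β]
    (P : Matrix α α ℂ) (Q : Matrix β β ℂ) (hQ : Q * Qᴴ = 1)
    (M : Matrix (α × β) (α × β) ℂ) :
    trSnd ((P ⊗ₖ Q)ᴴ * M * (P ⊗ₖ Q)) = Pᴴ * trSnd M * P := by
  have hQ' : ∀ y y', ∑ j, Q y j * star (Q y' j) = if y = y' then 1 else 0 := by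
    intro y y'
    have := congrFun (congrFun hQ y) y'
    simpa [Matrix.mul_apply, Matrix.one_apply] using this
  ext i i'
  simp only [trSnd, Matrix.of_apply, Matrix.mul_apply, Matrix.conjTranspose_apply,
    Matrix.kroneckerMap_apply, Fintype.sum_prod_type, Finset.sum_mul, star_mul']
  calc _ = ∑ x', ∑ y', ∑ x, ∑ y, star (P x i) * M (x, y) (x', y') * P x' i' *
        ∑ j, Q y' j * star (Q y j) := by
        simp only [Finset.mul_sum]
        rw [Finset.sum_comm]
        refine Finset.sum_congr rfl fun x' _ => ?_
        rw [Finset.sum_comm]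
        refine Finset.sum_congr rfl fun y' _ => ?_
        rw [Finset.sum_comm]
        refine Finset.sum_congr rfl fun x _ => ?_
        rw [Finset.sum_comm]
        refine Finset.sum_congr rfl fun y _ => ?_
        refine Finset.sum_congr rfl fun j _ => ?_
        ring
    _ = _ := by
        simp only [hQ', Finset.mul_sum, Finset.sum_mul]
        refine Finset.sum_congr rfl fun x' _ => ?_
        rw [Finset.sum_comm]
        refine Finset.sum_congr rfl fun x _ => ?_
        simp

lemma trFst_conj {α β : Type*} [Fintype α] [DecidableEq α] [Fintype β] [DecidableEq β]
    (P : Matrix α α ℂ) (Q : Matrix β β ℂ) (hP : P * Pᴴ = 1)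
    (M : Matrix (α × β) (α × β) ℂ) :
    trFst ((P ⊗ₖ Q)ᴴ * M * (P ⊗ₖ Q)) = Qᴴ * trFst M * Q := by
  have h := trSnd_conj Q P hP (M.submatrix Prod.swap Prod.swap)
  have e : ∀ N : Matrix (α × β) (α × β) ℂ, trFst N = trSnd (N.submatrix Prod.swap Prod.swap) := by
    intro N; rfl
  rw [e, e, ← h]
  congr 1
  have e2 : (Q ⊗ₖ P) = (P ⊗ₖ Q).submatrix (Equiv.prodComm β α) (Equiv.prodComm β α) := by
    ext ⟨a, b⟩ ⟨c, d⟩; simp [mul_comm]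
  have e3 : (Prod.swap : β × α → α × β) = Equiv.prodComm β α := rfl
  rw [e2, e3, Matrix.conjTranspose_submatrix, Matrix.submatrix_mul_equiv,
    Matrix.submatrix_mul_equiv]

lemma diag_conj {n : Type*} [Fintype n] [DecidableEq n] {ρ : Matrix n n ℂ}
    (h : ρ.IsHermitian) : ∃ U : Matrix n n ℂ, Uᴴ * U = 1 ∧ U * Uᴴ = 1 ∧
      Uᴴ * ρ * U = Matrix.diagonal (fun i => (h.eigenvalues i : ℂ)) ∧
      ρ = U * Matrix.diagonal (fun i => (h.eigenvalues i : ℂ)) * Uᴴ := by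
  refine ⟨h.eigenvectorUnitary, ?_, ?_, ?_, ?_⟩
  · exact Unitary.coe_star_mul_self _
  · exact Unitary.coe_mul_star_self _
  · have := h.conjStarAlgAut_star_eigenvectorUnitary
    rw [Unitary.conjStarAlgAut_star_apply] at this
    exact this
  · have := h.spectral_theorem
    rw [Unitary.conjStarAlgAut_apply] at this
    exact this

lemma ent_subadd {α β : Type*} [Fintype α] [DecidableEq α] [Fintype β] [DecidableEq β]
    (ρ : Matrix (α × β) (α × β) ℂ) (hρ : ρ.PosSemidef) (ht : ρ.trace = 1) :
    vnEntropy ρ ≤ vnEntropy (trSnd ρ) + vnEntropy (trFst ρ) := by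
  have h := hρ.1
  have hA : (trSnd ρ).IsHermitian := by
    ext i j
    simp only [trSnd, Matrix.conjTranspose_apply, Matrix.of_apply, star_sum]
    exact Finset.sum_congr rfl fun k _ => h.apply _ _
  have hB : (trFst ρ).IsHermitian := by
    ext i j
    simp only [trFst, Matrix.conjTranspose_apply, Matrix.of_apply, star_sum]
    exact Finset.sum_congr rfl fun k _ => h.apply _ _
  obtain ⟨U, U1, U2, -, U4⟩ := diag_conj h
  obtain ⟨P, P1, P2, P3, -⟩ := diag_conj hA
  obtain ⟨Q, Q1, Q2, Q3, -⟩ := diag_conj hB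
  have PQ : (P ⊗ₖ Q) * (P ⊗ₖ Q)ᴴ = 1 := by
    rw [Matrix.conjTranspose_kronecker, ← Matrix.mul_kronecker_mul, P2, Q2, Matrix.one_kronecker_one]
  have PQ' : (P ⊗ₖ Q)ᴴ * (P ⊗ₖ Q) = 1 := by
    rw [Matrix.conjTranspose_kronecker, ← Matrix.mul_kronecker_mul, P1, Q1, Matrix.one_kronecker_one]
  obtain ⟨T, hT⟩ : ∃ T, T = (P ⊗ₖ Q)ᴴ * U := ⟨_, rfl⟩
  have T1 : T * Tᴴ = 1 := by
    rw [hT, Matrix.conjTranspose_mul, Matrix.conjTranspose_conjTranspose, Matrix.mul_assoc,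
      ← Matrix.mul_assoc U, U2, Matrix.one_mul, PQ']
  have T2 : Tᴴ * T = 1 := by
    rw [hT, Matrix.conjTranspose_mul, Matrix.conjTranspose_conjTranspose, Matrix.mul_assoc,
      ← Matrix.mul_assoc (P ⊗ₖ Q), PQ, Matrix.one_mul, U1]
  have T3 : (P ⊗ₖ Q)ᴴ * ρ * (P ⊗ₖ Q) =
      T * Matrix.diagonal (fun i => (h.eigenvalues i : ℂ)) * Tᴴ := by
    conv_lhs => rw [U4]
    rw [hT, Matrix.conjTranspose_mul, Matrix.conjTranspose_conjTranspose]
    simp only [Matrix.mul_assoc]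
  have T4 : ∀ x, ((P ⊗ₖ Q)ᴴ * ρ * (P ⊗ₖ Q)) x x =
      ((∑ k, Complex.normSq (T x k) * h.eigenvalues k : ℝ) : ℂ) := by
    intro x
    rw [T3, Matrix.mul_apply]
    push_cast
    refine Finset.sum_congr rfl fun k _ => ?_
    rw [Matrix.mul_diagonal, Matrix.conjTranspose_apply, ← Complex.mul_conj]
    simp only [RCLike.star_def]
    ring
  have hc := ent_classical (fun k => h.eigenvalues k) hA.eigenvalues hB.eigenvalues
    (fun i j k => Complex.normSq (T (i, j) k)) (fun k => hρ.eigenvalues_nonneg k)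
    (fun i j k => Complex.normSq_nonneg _) ?_ ?_ ?_ ?_ ?_
  · rw [vnEntropy, vnEntropy, vnEntropy, dif_pos h, dif_pos hA, dif_pos hB]
    linarith
  · have := h.trace_eq_sum_eigenvalues
    rw [ht] at this
    have h5 : ((∑ k, h.eigenvalues k : ℝ) : ℂ) = ((1 : ℝ) : ℂ) := by
      rw [Complex.ofReal_sum, Complex.ofReal_one]; exact this.symm
    exact Complex.ofReal_injective h5
  · intro k
    have := congrFun (congrFun T2 k) k
    rw [Matrix.mul_apply, Matrix.one_apply_eq, Fintype.sum_prod_type] at this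
    rw [← Complex.ofReal_inj]
    push_cast
    rw [← this]
    refine Finset.sum_congr rfl fun i _ => Finset.sum_congr rfl fun j _ => ?_
    rw [Matrix.conjTranspose_apply, ← Complex.mul_conj, mul_comm]; rfl
  · intro i j
    have := congrFun (congrFun T1 (i, j)) (i, j)
    rw [Matrix.mul_apply, Matrix.one_apply_eq] at this
    rw [← Complex.ofReal_inj]
    push_cast
    rw [← this]
    refine Finset.sum_congr rfl fun k _ => ?_
    rw [Matrix.conjTranspose_apply, ← Complex.mul_conj]; rfl
  · intro i
    have := congrFun (congrFun ((trSnd_conj P Q Q2 ρ).trans P3) i) i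
    rw [Matrix.diagonal_apply_eq] at this
    simp only [trSnd, Matrix.of_apply, T4] at this
    exact_mod_cast this
  · intro i
    have := congrFun (congrFun ((trFst_conj P Q P2 ρ).trans Q3) i) i
    rw [Matrix.diagonal_apply_eq] at this
    simp only [trFst, Matrix.of_apply, T4] at this
    exact_mod_cast this

/-- Proposition 5: any quantum map that locally decreases entropy by `ΔS` must globally
increase entropy by at least `ΔS`. -/
theorem stmt18 {a b N : ℕ} (K : Fin N → Matrix (Fin a) (Fin a) ℂ)
    (htp : ∑ i, (K i)ᴴ * K i = 1)
    (G : Fin a × Fin b → ℂ) (hG : ∑ p, Complex.normSq (G p) = 1) :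
    vnEntropy (trSnd (Matrix.vecMulVec G (star G))) -
        vnEntropy (∑ i, K i * trSnd (Matrix.vecMulVec G (star G)) * (K i)ᴴ) ≤
      vnEntropy (∑ i,
        (K i ⊗ₖ (1 : Matrix (Fin b) (Fin b) ℂ)) * Matrix.vecMulVec G (star G) *
          (K i ⊗ₖ (1 : Matrix (Fin b) (Fin b) ℂ))ᴴ) := by
  obtain ⟨g, hg⟩ : ∃ g : Matrix (Fin a) (Fin b) ℂ, g = Matrix.of fun x k => G (x, k) := ⟨_, rfl⟩
  obtain ⟨V, hV⟩ : ∃ V : Matrix (Fin a × Fin N) (Fin a) ℂ, V = Matrix.of fun p y => K p.2 p.1 y :=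
    ⟨_, rfl⟩
  obtain ⟨W, hW⟩ : ∃ W : Matrix (Fin a × Fin b) (Fin N) ℂ,
    W = Matrix.of fun p i => (V * g) (p.1, i) p.2 := ⟨_, rfl⟩
  have hγ : trSnd (Matrix.vecMulVec G (star G)) = g * gᴴ := by
    ext i j
    simp [trSnd, Matrix.mul_apply, Matrix.vecMulVec_apply, hg]
  have hVV : Vᴴ * V = 1 := by
    rw [← htp]
    ext i j
    simp only [hV, Matrix.mul_apply, Matrix.sum_apply, Fintype.sum_prod_type,
      Matrix.conjTranspose_apply, Matrix.of_apply]
    exact Finset.sum_comm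
  have hS1 : vnEntropy (g * gᴴ) = vnEntropy ((V * g) * (V * g)ᴴ) := by
    rw [ent_mul_comm, ent_mul_comm, Matrix.conjTranspose_mul, Matrix.mul_assoc,
      ← Matrix.mul_assoc Vᴴ, hVV, Matrix.one_mul]
  have hA : trSnd ((V * g) * (V * g)ᴴ) = ∑ i, K i * (g * gᴴ) * (K i)ᴴ := by
    have e : ∀ i, K i * (g * gᴴ) * (K i)ᴴ = (K i * g) * (K i * g)ᴴ := by
      intro i; rw [Matrix.conjTranspose_mul]; simp only [Matrix.mul_assoc]
    ext x y
    simp only [e, trSnd, Matrix.of_apply, Matrix.sum_apply]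
    refine Finset.sum_congr rfl fun i _ => ?_
    simp [Matrix.mul_apply, hV]
  have hZ : (∑ i, (K i ⊗ₖ (1 : Matrix (Fin b) (Fin b) ℂ)) * Matrix.vecMulVec G (star G) *
          (K i ⊗ₖ (1 : Matrix (Fin b) (Fin b) ℂ))ᴴ) = W * Wᴴ := by
    have hv : ∀ i x, ((K i ⊗ₖ (1 : Matrix (Fin b) (Fin b) ℂ)) *ᵥ G) x = W x i := by
      rintro i ⟨x, k⟩
      simp [Matrix.mulVec, dotProduct, Fintype.sum_prod_type, hW, Matrix.mul_apply, hV, hg,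
        Matrix.one_apply]
    ext x y
    simp only [Matrix.mul_vecMulVec, Matrix.vecMulVec_mul, ← Matrix.star_mulVec]
    rw [Matrix.sum_apply, Matrix.mul_apply]
    refine Finset.sum_congr rfl fun i _ => ?_
    rw [Matrix.vecMulVec_apply, Pi.star_apply, hv, hv, Matrix.conjTranspose_apply]
  have hE : trFst ((V * g) * (V * g)ᴴ) = (Wᴴ * W)ᵀ := by
    ext i j
    rw [trFst, Matrix.of_apply, Matrix.transpose_apply, Matrix.mul_apply, Fintype.sum_prod_type]
    refine Finset.sum_congr rfl fun x _ => ?_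
    rw [Matrix.mul_apply]
    refine Finset.sum_congr rfl fun k _ => ?_
    rw [Matrix.conjTranspose_apply, Matrix.conjTranspose_apply, hW, Matrix.of_apply,
      Matrix.of_apply, mul_comm]
  have htr : ((V * g) * (V * g)ᴴ).trace = 1 := by
    rw [Matrix.trace_mul_comm, Matrix.conjTranspose_mul, Matrix.mul_assoc,
      ← Matrix.mul_assoc Vᴴ, hVV, Matrix.one_mul, Matrix.trace_mul_comm]
    have : ((∑ p, Complex.normSq (G p) : ℝ) : ℂ) = 1 := by rw [hG]; simp
    rw [← this]
    push_cast
    rw [Fintype.sum_prod_type, Matrix.trace]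
    refine Finset.sum_congr rfl fun x _ => ?_
    rw [Matrix.diag_apply, Matrix.mul_apply]
    refine Finset.sum_congr rfl fun k _ => ?_
    rw [Matrix.conjTranspose_apply, ← Complex.mul_conj, hg]; rfl
  have key := ent_subadd _ (Matrix.posSemidef_self_mul_conjTranspose (V * g)) htr
  rw [hA, hE, ent_transpose (Matrix.isHermitian_conjTranspose_mul_self W), ← ent_mul_comm,
    ← hS1] at key
  rw [hγ, hZ]
  linarith
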